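/- Let ψ_L ≤ ψ_U be integrable real random variables on a common probability space and Y an integrable real random variable, and suppose E[ψ_L] ≤ E[Y] ≤ E[ψ_U]; let F* be the unique element of 𝓕_B with ∫ u dF*(u) = E[Y]. Then the following are equivalent: (i) H₀B holds, i.e., there exist, on some probability space, random variables (Y', ψ') and a sub-σ-algebra I' with σ(ψ') ⊆ I', Y' distributed as Y, F_{ψ_U} ≤ F_{ψ'} ≤ F_{ψ_L} pointwise, and E[Y' | I'] = ψ' almost surely; (ii) E[ψ_L] ≤ E[Y] ≤ E[ψ_U] and ∫_{−∞}^y (F_Y(t) − F*(t)) dt ≥ 0 for all y ∈ ℝ. (More precisely, H₀B is equivalent to: E[ψ_L] ≤ E[Y] ≤ E[ψ_U] holds and the stated integral inequalities hold for F*.) -/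

import Mathlib

open MeasureTheory ProbabilityTheory

/-- `ψ^b = ψ_U·1{ψ_U < b} + max(b, ψ_L)·1{ψ_U ≥ b}`. -/
noncomputable def psiB {Ω : Type*} (ψL ψU : Ω → ℝ) (b : ℝ) (ω : Ω) : ℝ :=
  if ψU ω < b then ψU ω else max b (ψL ω)

/-- The family `𝓕_B` of candidate belief distributions: the laws of `ψ^b` for `b ∈ ℝ`,
together with the laws of `ψ^{-∞} = ψ_L` and `ψ^{∞} = ψ_U`. -/
def FB {Ω : Type*} [MeasurableSpace Ω] (P : Measure Ω) (ψL ψU : Ω → ℝ) :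
    Set (Measure ℝ) :=
  {μ | (∃ b : ℝ, μ = P.map (psiB ψL ψU b)) ∨ μ = P.map ψL ∨ μ = P.map ψU}

/-- H₀B realized on a given probability space `(Ω, P)`: there are `(Y', ψ')` and a
sub-σ-algebra `I'` with `σ(ψ') ⊆ I'`, `Y' ∼ μY`, `F_{ψ_U} ≤ F_{ψ'} ≤ F_{ψ_L}` pointwise and
`E[Y' | I'] = ψ'` almost surely. -/
def H0BOn (Ω : Type) [mΩ : MeasurableSpace Ω] (P : Measure Ω)
    (μY : Measure ℝ) (FL FU : ℝ → ℝ) : Prop :=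
  IsProbabilityMeasure P ∧
    ∃ Y' ψ' : Ω → ℝ,
      Measurable Y' ∧ Measurable ψ' ∧
      P.map Y' = μY ∧
      (∀ t : ℝ, FU t ≤ cdf (P.map ψ') t ∧ cdf (P.map ψ') t ≤ FL t) ∧
      ∃ I' : MeasurableSpace Ω,
        I' ≤ mΩ ∧
        MeasurableSpace.comap ψ' Real.measurableSpace ≤ I' ∧
        P[Y' | I'] =ᵐ[P] ψ'

open Set Filter Topology in
/-- A finite measure on the line is the image of Lebesgue measure on `(0, mass)` under its
quantile function. -/
lemma exists_quantile (α : Measure ℝ) [IsFiniteMeasure α] :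
    ∃ Q : ℝ → ℝ, Measurable Q ∧
      (∀ w ∈ Ioo 0 (α.real univ), ∀ x, Q w ≤ x ↔ w ≤ α.real (Iic x)) ∧
      (volume.restrict (Ioo 0 (α.real univ))).map Q = α := by
  classical
  have hmono : Monotone fun x => α.real (Iic x) := fun x y hxy =>
    measureReal_mono (Iic_subset_Iic.2 hxy)
  have hbot : Tendsto (fun x => α.real (Iic x)) atBot (𝓝 0) := by
    have h := tendsto_measure_iInter_atBot (μ := α) (s := fun x : ℝ => Iic x)
      (fun _ => measurableSet_Iic.nullMeasurableSet)
      (fun _ _ hxy => Iic_subset_Iic.2 hxy) ⟨0, measure_ne_top _ _⟩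
    have hI : ⋂ x : ℝ, Iic x = ∅ := by
      refine eq_empty_of_forall_notMem fun x hx => ?_
      have := mem_iInter.1 hx (x - 1)
      simp only [mem_Iic] at this
      linarith
    rw [hI, measure_empty] at h
    simpa using! (ENNReal.tendsto_toReal ENNReal.zero_ne_top).comp h
  have htop : Tendsto (fun x => α.real (Iic x)) atTop (𝓝 (α.real univ)) :=
    (ENNReal.tendsto_toReal (measure_ne_top α univ)).comp (tendsto_measure_Iic_atTop α)
  have hright : ∀ s, Tendsto (fun x => α.real (Iic x)) (𝓝[>] s) (𝓝 (α.real (Iic s))) := by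
    intro s
    have h := tendsto_measure_biInter_gt (μ := α) (s := fun x => Iic x) (a := s)
      (fun r _ => measurableSet_Iic.nullMeasurableSet)
      (fun i j _ hij => Iic_subset_Iic.2 hij) ⟨s + 1, by simp, measure_ne_top _ _⟩
    have hI : ⋂ r, ⋂ (_ : r > s), Iic r = Iic s := by
      ext x
      simp only [mem_iInter, mem_Iic]
      exact ⟨fun h => le_of_forall_gt_imp_ge_of_dense h, fun h r hr => h.trans hr.le⟩
    rw [hI] at h
    exact (ENNReal.tendsto_toReal (measure_ne_top α _)).comp h
  let Q : ℝ → ℝ := fun w =>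
    if w ∈ Ioo 0 (α.real univ) then sInf {x | w ≤ α.real (Iic x)} else 0
  have hQ : ∀ w ∈ Ioo 0 (α.real univ), ∀ x, Q w ≤ x ↔ w ≤ α.real (Iic x) := by
    intro w hw x
    have hQw : Q w = sInf {x | w ≤ α.real (Iic x)} := if_pos hw
    have hne : {x | w ≤ α.real (Iic x)}.Nonempty :=
      (htop.eventually (lt_mem_nhds hw.2)).exists.imp fun _ h => h.le
    have hbdd : BddBelow {x | w ≤ α.real (Iic x)} := by
      obtain ⟨y, hy⟩ := (hbot.eventually (gt_mem_nhds hw.1)).exists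
      exact ⟨y, fun z hz => le_of_not_gt fun h =>
        absurd (hz.trans (hmono h.le)) (not_le.2 hy)⟩
    rw [hQw]
    refine ⟨fun h => ?_, fun h => csInf_le hbdd h⟩
    refine le_trans ?_ (hmono h)
    refine ge_of_tendsto (hright _) ?_
    filter_upwards [self_mem_nhdsWithin] with z hz
    obtain ⟨t, ht, htz⟩ := exists_lt_of_csInf_lt hne hz
    exact le_trans ht (hmono htz.le)
  have hQm : Measurable Q := by
    refine measurable_of_Iic fun x => ?_
    have : Q ⁻¹' Iic x = (Ioo 0 (α.real univ) ∩ Iic (α.real (Iic x))) ∪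
        ((Ioo 0 (α.real univ))ᶜ ∩ {_w | (0 : ℝ) ≤ x}) := by
      ext w
      by_cases hw : w ∈ Ioo 0 (α.real univ)
      · simp only [mem_preimage, mem_Iic, mem_union, mem_inter_iff, hw, hQ w hw x, mem_compl_iff]
        simp
      · have : Q w = 0 := if_neg hw
        simp only [mem_preimage, mem_Iic, mem_union, mem_inter_iff, hw, this, mem_compl_iff]
        simp
    rw [this]
    exact (measurableSet_Ioo.inter measurableSet_Iic).union
      (measurableSet_Ioo.compl.inter (MeasurableSet.const _))
  refine ⟨Q, hQm, hQ, ?_⟩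
  have : IsFiniteMeasure (volume.restrict (Ioo 0 (α.real univ))) := ⟨by simp [Real.volume_Ioo]⟩
  refine Measure.ext_of_Iic _ _ fun x => ?_
  rw [Measure.map_apply hQm measurableSet_Iic,
    Measure.restrict_apply (hQm measurableSet_Iic)]
  have hsub : α.real (Iic x) ≤ α.real univ := measureReal_mono (subset_univ _)
  have hset : Q ⁻¹' Iic x ∩ Ioo 0 (α.real univ) =
      Iic (α.real (Iic x)) ∩ Ioo 0 (α.real univ) := by
    ext w
    simp only [mem_inter_iff, mem_preimage, mem_Iic]
    exact and_congr_left fun hw => hQ w hw x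
  have hae : (Iic (α.real (Iic x)) ∩ Ioo 0 (α.real univ) : Set ℝ) =ᵐ[volume]
      Ioc 0 (α.real (Iic x)) := by
    have h1 : (Ioo 0 (α.real univ) : Set ℝ) =ᵐ[volume] Ioc 0 (α.real univ) :=
      Ioo_ae_eq_Ioc
    have h2 := (ae_eq_refl (μ := volume) (Iic (α.real (Iic x)))).inter h1
    have h3 : Iic (α.real (Iic x)) ∩ Ioc 0 (α.real univ) = Ioc 0 (α.real (Iic x)) := by
      ext w
      simp only [mem_inter_iff, mem_Iic, mem_Ioc]
      exact ⟨fun h => ⟨h.2.1, h.1⟩, fun h => ⟨h.2, h.1, h.2.trans hsub⟩⟩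
    exact h2.trans (Eq.eventuallyEq h3)
  rw [hset, measure_congr hae, Real.volume_Ioc, sub_zero, ofReal_measureReal]

lemma lintegral_inv_mul_of_map_eq_withDensity {U V : Type*} [MeasurableSpace U]
    [MeasurableSpace V] {lam : Measure U} {Γ : Measure V} {g : V → U} (hg : Measurable g)
    {d : U → ℝ} (hd : Measurable d)
    (hΓ : Γ.map g = lam.withDensity fun u => ENNReal.ofReal (d u))
    {h : U → ENNReal} (hh : Measurable h) :
    ∫⁻ p, ENNReal.ofReal (d (g p))⁻¹ * h (g p) ∂Γ = ∫⁻ u in {u | 0 < d u}, h u ∂lam := by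
  have hm : Measurable fun u => ENNReal.ofReal (d u)⁻¹ * h u := by fun_prop
  rw [← lintegral_map hm hg, hΓ, lintegral_withDensity_eq_lintegral_mul _ (by fun_prop) hm,
    ← lintegral_indicator (measurableSet_lt measurable_const hd)]
  refine lintegral_congr fun u => ?_
  by_cases hu : 0 < d u
  · rw [Set.indicator_of_mem (by exact hu), Pi.mul_apply, ← mul_assoc,
      ← ENNReal.ofReal_mul hu.le, mul_inv_cancel₀ hu.ne', ENNReal.ofReal_one, one_mul]
  · rw [Set.indicator_of_notMem (by exact hu), Pi.mul_apply,
      ENNReal.ofReal_of_nonpos (not_lt.1 hu), zero_mul]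

lemma setLIntegral_eq_add_lt_add_gt {U : Type*} [MeasurableSpace U] {lam : Measure U}
    {X Z : U → ℝ} (hX : Measurable X) (hZ : Measurable Z) {h : U → ENNReal}
    (hh : Measurable h) :
    ∫⁻ u in {u | X u = Z u}, h u ∂lam +
      (∫⁻ u in {u | 0 < X u - Z u}, h u ∂lam + ∫⁻ u in {u | 0 < Z u - X u}, h u ∂lam) =
      ∫⁻ u, h u ∂lam := by
  have m0 := measurableSet_eq_fun hX hZ
  have m1 : MeasurableSet {u | 0 < X u - Z u} := measurableSet_lt measurable_const (hX.sub hZ)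
  have m2 : MeasurableSet {u | 0 < Z u - X u} := measurableSet_lt measurable_const (hZ.sub hX)
  rw [← lintegral_indicator m0, ← lintegral_indicator m1, ← lintegral_indicator m2,
    ← lintegral_add_left (hh.indicator m1), ← lintegral_add_left (hh.indicator m0)]
  refine lintegral_congr fun u => ?_
  rcases lt_trichotomy (X u) (Z u) with hu | hu | hu
  · simp [Set.indicator, hu, hu.ne, hu.not_gt]
  · simp [Set.indicator, hu]
  · simp [Set.indicator, hu, hu.ne', hu.not_gt]

/-- A coupling of the positive and the negative part of `X - Z` along which
`Z u < X u ≤ X v < Z v` yields a martingale coupling of the laws of `X` and `Z`: each pair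
`(u, v)` exchanges mass between the targets `Z u` and `Z v`. -/
lemma exists_martingale_coupling_of_exchange {U : Type*} [MeasurableSpace U] {lam : Measure U}
    {X Z : U → ℝ} (hX : Measurable X) (hZ : Measurable Z) {Γ : Measure (U × U)}
    (h1 : Γ.map Prod.fst = lam.withDensity fun u => ENNReal.ofReal (X u - Z u))
    (h2 : Γ.map Prod.snd = lam.withDensity fun u => ENNReal.ofReal (Z u - X u))
    (hord : ∀ᵐ p ∂Γ, Z p.1 < X p.1 ∧ X p.1 ≤ X p.2 ∧ X p.2 < Z p.2) :
    ∃ π : Measure (ℝ × ℝ), π.map Prod.fst = lam.map X ∧ π.map Prod.snd = lam.map Z ∧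
      ∀ A : Set ℝ, MeasurableSet A →
        ∫⁻ p, A.indicator 1 p.1 * ENNReal.ofReal (p.2 - p.1) ∂π =
          ∫⁻ p, A.indicator 1 p.1 * ENNReal.ofReal (p.1 - p.2) ∂π := by
  let e : U × U → ENNReal := fun p => ENNReal.ofReal (Z p.2 - Z p.1)⁻¹
  let k₁ : U × U → ENNReal := fun p =>
    ENNReal.ofReal ((X p.1 - Z p.1)⁻¹ - (Z p.2 - Z p.1)⁻¹)
  let k₂ : U × U → ENNReal := fun p =>
    ENNReal.ofReal ((Z p.2 - X p.2)⁻¹ - (Z p.2 - Z p.1)⁻¹)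
  have he : Measurable e := by fun_prop
  have hk₁ : Measurable k₁ := by fun_prop
  have hk₂ : Measurable k₂ := by fun_prop
  let π : Measure (ℝ × ℝ) :=
    (lam.restrict {u | X u = Z u}).map (fun u => (X u, Z u)) +
      ((Γ.withDensity k₁).map (fun p => (X p.1, Z p.1)) +
        (Γ.withDensity e).map (fun p => (X p.1, Z p.2)) +
        ((Γ.withDensity k₂).map (fun p => (X p.2, Z p.2)) +
          (Γ.withDensity e).map (fun p => (X p.2, Z p.1))))
  have key : ∀ f : ℝ × ℝ → ENNReal, Measurable f → ∫⁻ p, f p ∂π =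
      ∫⁻ u in {u | X u = Z u}, f (X u, Z u) ∂lam +
        ∫⁻ p, k₁ p * f (X p.1, Z p.1) + e p * f (X p.1, Z p.2) +
          (k₂ p * f (X p.2, Z p.2) + e p * f (X p.2, Z p.1)) ∂Γ := by
    intro f hf
    rw [lintegral_add_left (by fun_prop), lintegral_add_left (by fun_prop),
      lintegral_add_left (by fun_prop)]
    simp only [π, lintegral_add_measure]
    rw [lintegral_map hf (by fun_prop), lintegral_map hf (by fun_prop),
      lintegral_map hf (by fun_prop), lintegral_map hf (by fun_prop),
      lintegral_map hf (by fun_prop),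
      lintegral_withDensity_eq_lintegral_mul _ hk₁ (by fun_prop),
      lintegral_withDensity_eq_lintegral_mul _ hk₂ (by fun_prop),
      lintegral_withDensity_eq_lintegral_mul _ he (by fun_prop),
      lintegral_withDensity_eq_lintegral_mul _ he (by fun_prop)]
    rfl
  have marg : ∀ h : U → ENNReal, Measurable h →
      ∫⁻ u in {u | X u = Z u}, h u ∂lam +
        ∫⁻ p, ENNReal.ofReal (X p.1 - Z p.1)⁻¹ * h p.1 +
          ENNReal.ofReal (Z p.2 - X p.2)⁻¹ * h p.2 ∂Γ = ∫⁻ u, h u ∂lam := by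
    intro h hh
    rw [lintegral_add_left (by fun_prop),
      lintegral_inv_mul_of_map_eq_withDensity (d := fun u => X u - Z u)
        measurable_fst (hX.sub hZ) h1 hh,
      lintegral_inv_mul_of_map_eq_withDensity (d := fun u => Z u - X u)
        measurable_snd (hZ.sub hX) h2 hh,
      setLIntegral_eq_add_lt_add_gt hX hZ hh]
  have hsum : ∀ᵐ p ∂Γ, k₁ p + e p = ENNReal.ofReal (X p.1 - Z p.1)⁻¹ ∧
      k₂ p + e p = ENNReal.ofReal (Z p.2 - X p.2)⁻¹ := by
    filter_upwards [hord] with p ⟨ha, hb, hc⟩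
    have hD : 0 < Z p.2 - Z p.1 := by linarith
    have i1 : (Z p.2 - Z p.1)⁻¹ ≤ (X p.1 - Z p.1)⁻¹ :=
      inv_anti₀ (by linarith) (by linarith)
    have i2 : (Z p.2 - Z p.1)⁻¹ ≤ (Z p.2 - X p.2)⁻¹ :=
      inv_anti₀ (by linarith) (by linarith)
    have hD' := inv_pos.2 hD
    constructor
    · rw [← ENNReal.ofReal_add (by linarith) hD'.le, sub_add_cancel]
    · rw [← ENNReal.ofReal_add (by linarith) hD'.le, sub_add_cancel]
  refine ⟨π, Measure.ext_of_lintegral _ fun f hf => ?_,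
    Measure.ext_of_lintegral _ fun f hf => ?_, fun A hA => ?_⟩
  · rw [lintegral_map hf measurable_fst, lintegral_map hf hX, key _ (by fun_prop),
      ← marg _ (by fun_prop)]
    congr 1
    refine lintegral_congr_ae ?_
    filter_upwards [hsum] with p ⟨s1, s2⟩
    rw [← s1, ← s2]
    ring
  · rw [lintegral_map hf measurable_snd, lintegral_map hf hZ, key _ (by fun_prop),
      ← marg _ (by fun_prop)]
    congr 1
    refine lintegral_congr_ae ?_
    filter_upwards [hsum] with p ⟨s1, s2⟩
    rw [← s1, ← s2]
    ring
  · have hA1 : Measurable (A.indicator (1 : ℝ → ENNReal)) := measurable_one.indicator hA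
    rw [key _ (by fun_prop), key _ (by fun_prop)]
    congr 1
    · refine setLIntegral_congr_fun (measurableSet_eq_fun hX hZ) fun u hu => ?_
      have : X u = Z u := hu
      simp [this]
    · refine lintegral_congr_ae ?_
      filter_upwards [hord] with p ⟨ha, hb, hc⟩
      have hD : 0 < Z p.2 - Z p.1 := by linarith
      have hD' := inv_pos.2 hD
      have i1 : (Z p.2 - Z p.1)⁻¹ ≤ (X p.1 - Z p.1)⁻¹ :=
        inv_anti₀ (by linarith) (by linarith)
      have i2 : (Z p.2 - Z p.1)⁻¹ ≤ (Z p.2 - X p.2)⁻¹ :=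
        inv_anti₀ (by linarith) (by linarith)
      have e1 : k₁ p * ENNReal.ofReal (X p.1 - Z p.1) =
          e p * ENNReal.ofReal (Z p.2 - X p.1) := by
        rw [← ENNReal.ofReal_mul (by linarith), ← ENNReal.ofReal_mul hD'.le]
        congr 1
        have : X p.1 - Z p.1 ≠ 0 := by linarith
        field_simp
        ring
      have e2 : k₂ p * ENNReal.ofReal (Z p.2 - X p.2) =
          e p * ENNReal.ofReal (X p.2 - Z p.1) := by
        rw [← ENNReal.ofReal_mul (by linarith), ← ENNReal.ofReal_mul hD'.le]
        congr 1
        have : Z p.2 - X p.2 ≠ 0 := by linarith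
        field_simp
        ring
      have z1 : ENNReal.ofReal (Z p.1 - X p.1) = 0 := ENNReal.ofReal_of_nonpos (by linarith)
      have z2 : ENNReal.ofReal (X p.1 - Z p.2) = 0 := ENNReal.ofReal_of_nonpos (by linarith)
      have z3 : ENNReal.ofReal (X p.2 - Z p.2) = 0 := ENNReal.ofReal_of_nonpos (by linarith)
      have z4 : ENNReal.ofReal (Z p.1 - X p.2) = 0 := ENNReal.ofReal_of_nonpos (by linarith)
      simp only [z1, z2, z3, z4, mul_zero, zero_add, add_zero]
      rw [mul_left_comm, ← e1, mul_left_comm (k₂ p), e2]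
      ring

lemma lintegral_ofReal_const_sub_eq (m : Measure ℝ) [SFinite m] (y : ℝ) :
    ∫⁻ x, ENNReal.ofReal (y - x) ∂m = ∫⁻ t in Set.Iic y, m (Set.Iic t) := by
  have hS : MeasurableSet {p : ℝ × ℝ | p.1 ≤ p.2} := measurableSet_le measurable_fst measurable_snd
  have h1 : ∀ x, ENNReal.ofReal (y - x) =
      ∫⁻ t in Set.Iic y, {p : ℝ × ℝ | p.1 ≤ p.2}.indicator 1 (x, t) := by
    intro x
    have : (fun t => {p : ℝ × ℝ | p.1 ≤ p.2}.indicator (1 : ℝ × ℝ → ENNReal) (x, t)) =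
        (Set.Ici x).indicator 1 := rfl
    rw [this, lintegral_indicator_one measurableSet_Ici,
      Measure.restrict_apply measurableSet_Ici, Set.Ici_inter_Iic, Real.volume_Icc]
  have h2 : ∀ t, m (Set.Iic t) =
      ∫⁻ x, {p : ℝ × ℝ | p.1 ≤ p.2}.indicator 1 (x, t) ∂m := by
    intro t
    have : (fun x => {p : ℝ × ℝ | p.1 ≤ p.2}.indicator (1 : ℝ × ℝ → ENNReal) (x, t)) =
        (Set.Iic t).indicator 1 := rfl
    rw [this, lintegral_indicator_one measurableSet_Iic]
  simp_rw [h1, h2]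
  exact lintegral_lintegral_swap (measurable_one.indicator hS).aemeasurable

lemma lintegral_ofReal_sub_const_eq (m : Measure ℝ) [SFinite m] (y : ℝ) :
    ∫⁻ x, ENNReal.ofReal (x - y) ∂m = ∫⁻ t in Set.Ioi y, m (Set.Ioi t) := by
  have hS : MeasurableSet {p : ℝ × ℝ | p.2 < p.1} := measurableSet_lt measurable_snd measurable_fst
  have h1 : ∀ x, ENNReal.ofReal (x - y) =
      ∫⁻ t in Set.Ioi y, {p : ℝ × ℝ | p.2 < p.1}.indicator 1 (x, t) := by
    intro x
    have : (fun t => {p : ℝ × ℝ | p.2 < p.1}.indicator (1 : ℝ × ℝ → ENNReal) (x, t)) =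
        (Set.Iio x).indicator 1 := rfl
    rw [this, lintegral_indicator_one measurableSet_Iio,
      Measure.restrict_apply measurableSet_Iio, Set.inter_comm, Set.Ioi_inter_Iio,
      Real.volume_Ioo]
  have h2 : ∀ t, m (Set.Ioi t) =
      ∫⁻ x, {p : ℝ × ℝ | p.2 < p.1}.indicator 1 (x, t) ∂m := by
    intro t
    have : (fun x => {p : ℝ × ℝ | p.2 < p.1}.indicator (1 : ℝ × ℝ → ENNReal) (x, t)) =
        (Set.Ioi t).indicator 1 := rfl
    rw [this, lintegral_indicator_one measurableSet_Ioi]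
  simp_rw [h1, h2]
  exact lintegral_lintegral_swap (measurable_one.indicator hS).aemeasurable

lemma integral_max_zero_eq_toReal {V : Type*} [MeasurableSpace V] {m : Measure V} {f : V → ℝ}
    (hf : AEStronglyMeasurable f m) :
    ∫ x, max (f x) 0 ∂m = (∫⁻ x, ENNReal.ofReal (f x) ∂m).toReal := by
  have hm : AEStronglyMeasurable (fun x => max (f x) 0) m := hf.sup aestronglyMeasurable_const
  rw [integral_eq_lintegral_of_nonneg_ae (f := fun x => max (f x) 0)
    (ae_of_all _ fun x => le_max_right _ _) hm]
  congr 1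
  refine lintegral_congr fun x => ?_
  rcases le_total (f x) 0 with h | h
  · rw [max_eq_right h, ENNReal.ofReal_zero, ENNReal.ofReal_of_nonpos h]
  · rw [max_eq_left h]

lemma integrableOn_cdf_Iic {m : Measure ℝ} [IsProbabilityMeasure m]
    (hm : Integrable (fun x => x) m) (y : ℝ) :
    IntegrableOn (cdf m) (Set.Iic y) := by
  refine ⟨(monotone_cdf m).measurable.aestronglyMeasurable, ?_⟩
  rw [hasFiniteIntegral_iff_ofReal (ae_of_all _ fun t => cdf_nonneg m t)]
  simp_rw [ofReal_cdf, ← lintegral_ofReal_const_sub_eq]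
  exact (Integrable.lintegral_lt_top (f := fun x => y - x) ((integrable_const y).sub hm))

lemma integral_cdf_Iic {m : Measure ℝ} [IsProbabilityMeasure m] (y : ℝ) :
    ∫ t in Set.Iic y, cdf m t = ∫ x, max (y - x) 0 ∂m := by
  rw [integral_max_zero_eq_toReal (by fun_prop), lintegral_ofReal_const_sub_eq,
    integral_eq_lintegral_of_nonneg_ae (ae_of_all _ fun t => cdf_nonneg m t)
      (monotone_cdf m).measurable.aestronglyMeasurable]
  simp_rw [ofReal_cdf]

lemma integral_max_sub_const {m : Measure ℝ} [IsProbabilityMeasure m]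
    (hm : Integrable (fun x => x) m) (y : ℝ) :
    ∫ x, max (y - x) 0 ∂m = ∫ x, max (x - y) 0 ∂m + (y - ∫ x, x ∂m) := by
  have h1 : Integrable (fun x => max (x - y) 0) m := (hm.sub (integrable_const y)).pos_part
  have h2 : y - ∫ x, x ∂m = ∫ x, (y - x) ∂m := by
    rw [integral_sub (integrable_const y) hm]; simp
  have h3 : Integrable (fun x => y - x) m := (integrable_const y).sub hm
  rw [h2, ← integral_add h1 h3]
  refine integral_congr_ae (ae_of_all _ fun x => ?_)
  rcases le_total x y with h | h
  · simp only
    rw [max_eq_left (by linarith), max_eq_right (by linarith)]; ring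
  · simp only
    rw [max_eq_right (by linarith), max_eq_left (by linarith)]; ring

/-- If two laws have the same mean and their cdfs are ordered on one side of `y`, then their
put transforms at `y` are ordered. -/
lemma integral_max_const_sub_le {m₁ m₂ : Measure ℝ} [IsProbabilityMeasure m₁]
    [IsProbabilityMeasure m₂] (h₁ : Integrable (fun x => x) m₁) (h₂ : Integrable (fun x => x) m₂)
    (hmean : ∫ x, x ∂m₁ = ∫ x, x ∂m₂) {y : ℝ}
    (h : (∀ t < y, cdf m₁ t ≤ cdf m₂ t) ∨ ∀ t > y, cdf m₂ t ≤ cdf m₁ t) :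
    ∫ x, max (y - x) 0 ∂m₁ ≤ ∫ x, max (y - x) 0 ∂m₂ := by
  rcases h with h | h
  · rw [← integral_cdf_Iic, ← integral_cdf_Iic]
    refine setIntegral_mono_on_ae (integrableOn_cdf_Iic h₁ y) (integrableOn_cdf_Iic h₂ y)
      measurableSet_Iic ?_
    filter_upwards [Measure.ae_ne volume y] with t ht hty
    exact h t (lt_of_le_of_ne hty ht)
  · rw [integral_max_sub_const h₁, integral_max_sub_const h₂, hmean]
    gcongr ?_ + _
    rw [integral_max_zero_eq_toReal (by fun_prop), integral_max_zero_eq_toReal (by fun_prop)]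
    refine ENNReal.toReal_mono ?_ ?_
    · exact (Integrable.lintegral_lt_top (f := fun x => x - y) (h₂.sub (integrable_const y))).ne
    · rw [lintegral_ofReal_sub_const_eq, lintegral_ofReal_sub_const_eq]
      refine setLIntegral_mono' measurableSet_Ioi fun t ht => ?_
      rw [← Set.compl_Iic, prob_compl_eq_one_sub measurableSet_Iic,
        prob_compl_eq_one_sub measurableSet_Iic, ← ofReal_cdf, ← ofReal_cdf]
      exact tsub_le_tsub_left (ENNReal.ofReal_le_ofReal (h t ht)) _

open Set in
/-- Strassen's theorem on the line: laws in convex order (equal means and ordered put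
transforms) admit a martingale coupling. -/
theorem exists_martingale_coupling {ν μ : Measure ℝ} [IsProbabilityMeasure ν]
    [IsProbabilityMeasure μ] (hν : Integrable (fun x => x) ν) (hμ : Integrable (fun x => x) μ)
    (hmean : ∫ x, x ∂ν = ∫ x, x ∂μ)
    (hput : ∀ y, ∫ x, max (y - x) 0 ∂ν ≤ ∫ x, max (y - x) 0 ∂μ) :
    ∃ π : Measure (ℝ × ℝ), π.map Prod.fst = ν ∧ π.map Prod.snd = μ ∧
      π[Prod.snd | MeasurableSpace.comap Prod.fst Real.measurableSpace] =ᵐ[π] Prod.fst := by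
  obtain ⟨X, hX, hXq, hXν⟩ := exists_quantile ν
  obtain ⟨Z, hZ, hZq, hZμ⟩ := exists_quantile μ
  rw [probReal_univ] at hXq hXν hZq hZμ
  set lam : Measure ℝ := volume.restrict (Ioo 0 1) with hlam
  have hlam_prob : IsProbabilityMeasure lam := ⟨by simp [hlam]⟩
  have hlam_mem : ∀ᵐ w ∂lam, w ∈ Ioo (0 : ℝ) 1 := ae_restrict_mem measurableSet_Ioo
  have hXmono : ∀ u ∈ Ioo (0 : ℝ) 1, ∀ v ∈ Ioo (0 : ℝ) 1, u ≤ v → X u ≤ X v :=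
    fun u hu v hv huv => (hXq u hu _).2 (huv.trans ((hXq v hv _).1 le_rfl))
  have hZmono : ∀ u ∈ Ioo (0 : ℝ) 1, ∀ v ∈ Ioo (0 : ℝ) 1, u ≤ v → Z u ≤ Z v :=
    fun u hu v hv huv => (hZq u hu _).2 (huv.trans ((hZq v hv _).1 le_rfl))
  have hXi : Integrable X lam := by
    rw [← hXν] at hν
    exact hν.comp_measurable hX
  have hZi : Integrable Z lam := by
    rw [← hZμ] at hμ
    exact hμ.comp_measurable hZ
  have hdi : Integrable (fun u => X u - Z u) lam := hXi.sub hZi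
  have hdi' : Integrable (fun u => Z u - X u) lam := hZi.sub hXi
  have hmean0 : ∫ u, (X u - Z u) ∂lam = 0 := by
    rw [integral_sub hXi hZi, ← integral_map (f := fun x => x) hX.aemeasurable (by fun_prop),
      ← integral_map (f := fun x => x) hZ.aemeasurable (by fun_prop), hXν, hZμ, hmean, sub_self]
  have hput' : ∀ y, ∫ u, max (y - X u) 0 ∂lam ≤ ∫ u, max (y - Z u) 0 ∂lam := by
    intro y
    have := hput y
    rwa [← hXν, ← hZμ, integral_map hX.aemeasurable (by fun_prop),
      integral_map hZ.aemeasurable (by fun_prop)] at this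
  have hcum : ∀ u, 0 ≤ ∫ v in Iic u, (X v - Z v) ∂lam := by
    intro u
    rcases le_or_gt u 0 with hu0 | hu0
    · have h : ∀ᵐ v ∂lam, v ∉ Iic u := hlam_mem.mono fun v hv h => by
        have := hv.1; simp only [mem_Iic] at h; linarith
      rw [Measure.restrict_eq_zero.2 (measure_eq_zero_iff_ae_notMem.2 h), integral_zero_measure]
    rcases le_or_gt 1 u with hu1 | hu1
    · have h : ∀ᵐ v ∂lam, v ∈ Iic u := hlam_mem.mono fun v hv => hv.2.le.trans hu1
      rw [Measure.restrict_eq_self_of_ae_mem h, hmean0]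
    have hu : u ∈ Ioo (0 : ℝ) 1 := ⟨hu0, hu1⟩
    have iX : Integrable (fun v => Z u - X v) lam := (integrable_const _).sub hXi
    have iZ : Integrable (fun v => Z u - Z v) lam := (integrable_const _).sub hZi
    have h1 : ∫ v in Iic u, (Z u - X v) ∂lam ≤ ∫ v, max (Z u - X v) 0 ∂lam :=
      (setIntegral_mono iX.integrableOn iX.pos_part.integrableOn fun v => le_max_left _ _).trans
        (setIntegral_le_integral iX.pos_part (ae_of_all _ fun v => le_max_right _ _))
    have h2 : ∫ v, max (Z u - Z v) 0 ∂lam = ∫ v in Iic u, (Z u - Z v) ∂lam := by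
      rw [← integral_indicator measurableSet_Iic]
      refine integral_congr_ae (hlam_mem.mono fun v hv => ?_)
      rcases le_or_gt v u with hvu | hvu
      · rw [indicator_of_mem (by exact hvu)]
        exact max_eq_left (sub_nonneg.2 (hZmono v hv u hu hvu))
      · rw [indicator_of_notMem (by simpa using hvu)]
        exact max_eq_right (sub_nonpos.2 (hZmono u hu v hv hvu.le))
    have h3 : ∫ v in Iic u, (X v - Z v) ∂lam =
        ∫ v in Iic u, (Z u - Z v) ∂lam - ∫ v in Iic u, (Z u - X v) ∂lam := by
      rw [← integral_sub iZ.integrableOn iX.integrableOn]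
      simp
    have := hput' (Z u)
    linarith
  let α := lam.withDensity fun u => ENNReal.ofReal (X u - Z u)
  let β := lam.withDensity fun u => ENNReal.ofReal (Z u - X u)
  have : IsFiniteMeasure α := isFiniteMeasure_withDensity_ofReal hdi.2
  have : IsFiniteMeasure β := isFiniteMeasure_withDensity_ofReal hdi'.2
  have hαβ : ∀ s, MeasurableSet s → ∫ v in s, (X v - Z v) ∂lam = α.real s - β.real s := by
    intro s hs
    rw [integral_eq_lintegral_pos_part_sub_lintegral_neg_part hdi.integrableOn,
      measureReal_def, measureReal_def, withDensity_apply _ hs, withDensity_apply _ hs]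
    simp only [neg_sub]
  have hmass : β.real univ = α.real univ := by
    have := hαβ univ MeasurableSet.univ
    rw [Measure.restrict_univ, hmean0] at this
    linarith
  have hle : ∀ u, β.real (Iic u) ≤ α.real (Iic u) := fun u => by
    have := hαβ (Iic u) measurableSet_Iic
    have := hcum u
    linarith
  obtain ⟨A, hA, hAq, hAα⟩ := exists_quantile α
  obtain ⟨B, hB, hBq, hBβ⟩ := exists_quantile β
  rw [hmass] at hBq hBβ
  set lam' : Measure ℝ := volume.restrict (Ioo 0 (α.real univ)) with hlam'
  have hα_ae : ∀ᵐ u ∂α, u ∈ Ioo (0 : ℝ) 1 ∧ Z u < X u := by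
    rw [ae_withDensity_iff (by fun_prop)]
    filter_upwards [hlam_mem] with u hu h
    exact ⟨hu, by simpa using h⟩
  have hβ_ae : ∀ᵐ u ∂β, u ∈ Ioo (0 : ℝ) 1 ∧ X u < Z u := by
    rw [ae_withDensity_iff (by fun_prop)]
    filter_upwards [hlam_mem] with u hu h
    exact ⟨hu, by simpa using h⟩
  obtain ⟨π, hπ1, hπ2, hπA⟩ := exists_martingale_coupling_of_exchange (lam := lam) hX hZ
    (Γ := lam'.map fun w => (A w, B w))
    (by rw [Measure.map_map measurable_fst (hA.prodMk hB)]; exact hAα)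
    (by rw [Measure.map_map measurable_snd (hA.prodMk hB)]; exact hBβ)
    (by
      rw [ae_map_iff (hA.prodMk hB).aemeasurable (by measurability)]
      rw [← hAα] at hα_ae
      rw [← hBβ] at hβ_ae
      filter_upwards [ae_of_ae_map hA.aemeasurable hα_ae, ae_of_ae_map hB.aemeasurable hβ_ae,
        ae_restrict_mem (μ := volume) (measurableSet_Ioo (a := 0) (b := α.real univ))]
        with w h1 h2 hw
      have hAB : A w ≤ B w := (hAq w hw _).2 (((hBq w hw _).1 le_rfl).trans (hle _))
      exact ⟨h1.2, hXmono _ h1.1 _ h2.1 hAB, h2.2⟩)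
  rw [hXν] at hπ1
  rw [hZμ] at hπ2
  have hπ_prob : IsProbabilityMeasure π := by
    constructor
    rw [← preimage_univ (f := Prod.fst), ← Measure.map_apply measurable_fst .univ, hπ1,
      measure_univ]
  have hfst : Integrable Prod.fst π := by
    rw [← hπ1] at hν
    exact hν.comp_measurable measurable_fst
  have hsnd : Integrable Prod.snd π := by
    rw [← hπ2] at hμ
    exact hμ.comp_measurable measurable_snd
  refine ⟨π, hπ1, hπ2, ?_⟩
  have hm : MeasurableSpace.comap Prod.fst Real.measurableSpace ≤
      (inferInstance : MeasurableSpace (ℝ × ℝ)) := measurable_fst.comap_le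
  refine (ae_eq_condExp_of_forall_setIntegral_eq hm hsnd
    (fun _ _ _ => hfst.integrableOn) ?_ ?_).symm
  · rintro _ ⟨S, hS, rfl⟩ -
    have hd : Integrable (fun p : ℝ × ℝ => p.2 - p.1) π := hsnd.sub hfst
    have hSm : MeasurableSet (Prod.fst ⁻¹' S : Set (ℝ × ℝ)) := measurable_fst hS
    have hind : ∀ f : ℝ × ℝ → ENNReal,
        ∫⁻ p in Prod.fst ⁻¹' S, f p ∂π = ∫⁻ p, S.indicator 1 p.1 * f p ∂π := by
      intro f
      rw [← lintegral_indicator hSm]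
      refine lintegral_congr fun p => ?_
      by_cases hp : p.1 ∈ S <;> simp [indicator, hp]
    have h0 : ∫ p in Prod.fst ⁻¹' S, (p.2 - p.1) ∂π = 0 := by
      rw [integral_eq_lintegral_pos_part_sub_lintegral_neg_part hd.integrableOn]
      simp only [neg_sub]
      rw [hind, hind, hπA S hS, sub_self]
    rw [integral_sub hsnd.integrableOn hfst.integrableOn] at h0
    linarith
  · exact (comap_measurable Prod.fst).stronglyMeasurable.aestronglyMeasurable

lemma condExp_ae_eq_imp_convex_order {V : Type*} {m m₀ : MeasurableSpace V}
    {μ : Measure V} [IsFiniteMeasure μ] (hm : m ≤ m₀) {f g : V → ℝ} (hf : Integrable f μ)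
    (hgm : Measurable[m] g) (h : μ[f | m] =ᵐ[μ] g) :
    Integrable g μ ∧ ∫ x, g x ∂μ = ∫ x, f x ∂μ ∧
      ∀ y, ∫ x, max (y - g x) 0 ∂μ ≤ ∫ x, max (y - f x) 0 ∂μ := by
  have hg : Integrable g μ := integrable_condExp.congr h
  refine ⟨hg, by rw [← integral_congr_ae h, integral_condExp hm], fun y => ?_⟩
  have hS : MeasurableSet[m] {x | g x ≤ y} := hgm measurableSet_Iic
  have hS' : MeasurableSet {x | g x ≤ y} := hm _ hS
  have iF : Integrable (fun x => y - f x) μ := (integrable_const y).sub hf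
  have h1 : ∫ x, max (y - g x) 0 ∂μ = ∫ x in {x | g x ≤ y}, (y - g x) ∂μ := by
    rw [← integral_indicator hS']
    refine integral_congr_ae (ae_of_all _ fun x => ?_)
    by_cases hx : g x ≤ y
    · rw [Set.indicator_of_mem (by exact hx)]
      exact max_eq_left (sub_nonneg.2 hx)
    · rw [Set.indicator_of_notMem (by exact hx)]
      exact max_eq_right (sub_nonpos.2 (not_le.1 hx).le)
  have h2 : ∫ x in {x | g x ≤ y}, g x ∂μ = ∫ x in {x | g x ≤ y}, f x ∂μ := by
    rw [← setIntegral_condExp hm hf hS]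
    exact setIntegral_congr_ae hS' (h.mono fun x hx _ => hx.symm)
  have h3 : ∫ x in {x | g x ≤ y}, (y - g x) ∂μ = ∫ x in {x | g x ≤ y}, (y - f x) ∂μ := by
    rw [integral_sub (integrable_const y) hg.integrableOn,
      integral_sub (integrable_const y) hf.integrableOn, h2]
  rw [h1, h3]
  exact (setIntegral_mono iF.integrableOn iF.pos_part.integrableOn fun x => le_max_left _ _).trans
    (setIntegral_le_integral iF.pos_part (ae_of_all _ fun x => le_max_right _ _))

lemma integral_cdf_sub_cdf_Iic_nonneg_iff {m₁ m₂ : Measure ℝ} [IsProbabilityMeasure m₁]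
    [IsProbabilityMeasure m₂] (h₁ : Integrable (fun x => x) m₁)
    (h₂ : Integrable (fun x => x) m₂) (y : ℝ) :
    0 ≤ ∫ t in Set.Iic y, (cdf m₁ t - cdf m₂ t) ↔
      ∫ x, max (y - x) 0 ∂m₂ ≤ ∫ x, max (y - x) 0 ∂m₁ := by
  rw [integral_sub (integrableOn_cdf_Iic h₁ y) (integrableOn_cdf_Iic h₂ y), sub_nonneg,
    integral_cdf_Iic, integral_cdf_Iic]

section Belief

variable {Ω : Type*} {ψL ψU : Ω → ℝ}

lemma psiB_mem_Icc (hle : ∀ ω, ψL ω ≤ ψU ω) (b : ℝ) (ω : Ω) :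
    psiB ψL ψU b ω ∈ Set.Icc (ψL ω) (ψU ω) := by
  unfold psiB
  split_ifs with h
  · exact ⟨hle ω, le_rfl⟩
  · exact ⟨le_max_right _ _, max_le (not_lt.1 h) (hle ω)⟩

lemma psiB_le_iff_of_lt {b t : ℝ} (ht : t < b) (ω : Ω) : psiB ψL ψU b ω ≤ t ↔ ψU ω ≤ t := by
  unfold psiB
  split_ifs with h
  · rfl
  · exact ⟨fun h' => absurd ((le_max_left _ _).trans h') (not_le.2 ht),
      fun h' => absurd (h'.trans_lt ht) h⟩

lemma psiB_le_iff_of_le (hle : ∀ ω, ψL ω ≤ ψU ω) {b t : ℝ} (ht : b ≤ t) (ω : Ω) :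
    psiB ψL ψU b ω ≤ t ↔ ψL ω ≤ t := by
  unfold psiB
  split_ifs with h
  · exact ⟨fun h' => (hle ω).trans h', fun _ => (h.le.trans ht)⟩
  · simp [ht]

variable [MeasurableSpace Ω] {P : Measure Ω}

lemma cdf_map_eq_measureReal [IsProbabilityMeasure P] {f : Ω → ℝ} (hf : Measurable f) (t : ℝ) :
    cdf (P.map f) t = P.real {ω | f ω ≤ t} := by
  have := Measure.isProbabilityMeasure_map (μ := P) hf.aemeasurable
  rw [cdf_eq_real, map_measureReal_apply hf measurableSet_Iic]
  rfl

lemma cdf_map_anti [IsProbabilityMeasure P] {f g : Ω → ℝ} (hf : Measurable f)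
    (hg : Measurable g) (h : ∀ ω, f ω ≤ g ω) (t : ℝ) :
    cdf (P.map g) t ≤ cdf (P.map f) t := by
  rw [cdf_map_eq_measureReal hf, cdf_map_eq_measureReal hg]
  exact measureReal_mono fun ω hω => (h ω).trans hω

/-- Every member of `FB` is the law of a variable between `ψL` and `ψU` whose cdf agrees with
that of `ψU` below some threshold and with that of `ψL` above it. -/
lemma exists_map_eq_of_mem_FB [IsProbabilityMeasure P] (hL : Measurable ψL) (hU : Measurable ψU)
    (hle : ∀ ω, ψL ω ≤ ψU ω) {μ : Measure ℝ} (hμ : μ ∈ FB P ψL ψU) :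
    ∃ f : Ω → ℝ, Measurable f ∧ μ = P.map f ∧ (∀ ω, f ω ∈ Set.Icc (ψL ω) (ψU ω)) ∧
      ∀ y, (∀ t < y, cdf μ t = cdf (P.map ψU) t) ∨ ∀ t > y, cdf μ t = cdf (P.map ψL) t := by
  rcases hμ with ⟨b, rfl⟩ | rfl | rfl
  · have hb : Measurable (psiB ψL ψU b) :=
      Measurable.ite (measurableSet_lt hU measurable_const) hU (measurable_const.max hL)
    refine ⟨_, hb, rfl, psiB_mem_Icc hle b, fun y => ?_⟩
    rcases le_total y b with hy | hy
    · refine Or.inl fun t ht => ?_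
      rw [cdf_map_eq_measureReal hb, cdf_map_eq_measureReal hU]
      simp_rw [psiB_le_iff_of_lt (ht.trans_le hy)]
    · refine Or.inr fun t ht => ?_
      rw [cdf_map_eq_measureReal hb, cdf_map_eq_measureReal hL]
      simp_rw [psiB_le_iff_of_le hle (hy.trans (le_of_lt ht))]
  · exact ⟨ψL, hL, rfl, fun ω => ⟨le_rfl, hle ω⟩, fun y => Or.inr fun _ _ => rfl⟩
  · exact ⟨ψU, hU, rfl, fun ω => ⟨hle ω, le_rfl⟩, fun y => Or.inl fun _ _ => rfl⟩

end Belief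

/-- Second part of Proposition 8 of the paper: H₀B holds if and only if
`E[ψ_L] ≤ E[Y] ≤ E[ψ_U]` and `Δ_{F*}(y) = ∫_{-∞}^y (F_Y(t) - F*(t)) dt ≥ 0` for all `y`,
where `F*` is the unique element of `𝓕_B` with mean `E[Y]`. -/
theorem H0B_iff_moment_conditions
    {Ω Ω' : Type*} [MeasurableSpace Ω] [MeasurableSpace Ω']
    (P : Measure Ω) (P' : Measure Ω')
    [IsProbabilityMeasure P] [IsProbabilityMeasure P']
    {ψL ψU : Ω → ℝ} {Y : Ω' → ℝ}
    (hψLm : Measurable ψL) (hψUm : Measurable ψU)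
    (hψLi : Integrable ψL P) (hψUi : Integrable ψU P)
    (hle : ∀ ω, ψL ω ≤ ψU ω)
    (hYm : Measurable Y) (hYi : Integrable Y P')
    (hlow : ∫ ω, ψL ω ∂P ≤ ∫ ω, Y ω ∂P')
    (hup : ∫ ω, Y ω ∂P' ≤ ∫ ω, ψU ω ∂P)
    (μstar : Measure ℝ) (hμstar : μstar ∈ FB P ψL ψU)
    (hμstarMean : ∫ x : ℝ, x ∂μstar = ∫ ω, Y ω ∂P') :
    (∃ (Ωx : Type) (mΩx : MeasurableSpace Ωx) (Px : @Measure Ωx mΩx),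
        @H0BOn Ωx mΩx Px (P'.map Y)
          (fun t => cdf (P.map ψL) t) (fun t => cdf (P.map ψU) t)) ↔
      ((∫ ω, ψL ω ∂P ≤ ∫ ω, Y ω ∂P' ∧ ∫ ω, Y ω ∂P' ≤ ∫ ω, ψU ω ∂P) ∧
        ∀ y : ℝ, 0 ≤ ∫ t in Set.Iic y, (cdf (P'.map Y) t - cdf μstar t)) := by
  obtain ⟨f, hf, rfl, hfmem, hfcdf⟩ := exists_map_eq_of_mem_FB hψLm hψUm hle hμstar
  have hfi : Integrable f P := by
    refine (hψLi.abs.add hψUi.abs).mono' hf.aestronglyMeasurable (ae_of_all _ fun ω => ?_)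
    have h := hfmem ω
    exact (abs_le_max_abs_abs h.1 h.2).trans
      (max_le_add_of_nonneg (abs_nonneg _) (abs_nonneg _))
  have := Measure.isProbabilityMeasure_map (μ := P) hf.aemeasurable
  have := Measure.isProbabilityMeasure_map (μ := P') hYm.aemeasurable
  have iF : Integrable (fun x => x) (P.map f) :=
    (integrable_map_measure (by fun_prop) hf.aemeasurable).2 hfi
  have iY : Integrable (fun x => x) (P'.map Y) :=
    (integrable_map_measure (by fun_prop) hYm.aemeasurable).2 hYi
  have hYmean : ∫ x, x ∂(P'.map Y) = ∫ ω, Y ω ∂P' :=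
    integral_map hYm.aemeasurable (by fun_prop)
  simp_rw [integral_cdf_sub_cdf_Iic_nonneg_iff iY iF]
  constructor
  · rintro ⟨Ωx, mΩx, Px, hPx, Y', ψ', hY', hψ', hlaw, hcdf, hI⟩
    refine ⟨⟨hlow, hup⟩, fun y => ?_⟩
    have := Measure.isProbabilityMeasure_map (μ := Px) hψ'.aemeasurable
    have hY'i : Integrable Y' Px := by
      rw [← hlaw] at iY
      exact iY.comp_measurable hY'
    obtain ⟨hψ'i, hψ'mean, hψ'put⟩ : Integrable ψ' Px ∧ ∫ ω, ψ' ω ∂Px = ∫ ω, Y' ω ∂Px ∧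
        ∀ y, ∫ ω, max (y - ψ' ω) 0 ∂Px ≤ ∫ ω, max (y - Y' ω) 0 ∂Px := by
      obtain ⟨I', hI', hσ, hcond⟩ := hI
      exact condExp_ae_eq_imp_convex_order hI' hY'i ((comap_measurable ψ').mono hσ le_rfl) hcond
    have iψ : Integrable (fun x => x) (Px.map ψ') :=
      (integrable_map_measure (by fun_prop) hψ'.aemeasurable).2 hψ'i
    have hmean : ∫ x, x ∂(P.map f) = ∫ x, x ∂(Px.map ψ') := by
      rw [hμstarMean, ← hYmean, ← hlaw, integral_map hY'.aemeasurable (by fun_prop),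
        integral_map hψ'.aemeasurable (by fun_prop), hψ'mean]
    refine (integral_max_const_sub_le iF iψ hmean ?_).trans ?_
    · refine (hfcdf y).imp (fun h t ht => ?_) fun h t ht => ?_
      · rw [h t ht]; exact (hcdf t).1
      · rw [h t ht]; exact (hcdf t).2
    · rw [← hlaw, integral_map hY'.aemeasurable (by fun_prop),
        integral_map hψ'.aemeasurable (by fun_prop)]
      exact hψ'put y
  · rintro ⟨-, hput⟩
    obtain ⟨π, hπ1, hπ2, hπ⟩ :=
      exists_martingale_coupling iF iY (hμstarMean.trans hYmean.symm) hput
    have hπ_prob : IsProbabilityMeasure π := by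
      constructor
      rw [← Set.preimage_univ (f := Prod.fst), ← Measure.map_apply measurable_fst .univ, hπ1,
        measure_univ]
    refine ⟨ℝ × ℝ, inferInstance, π, hπ_prob, Prod.snd, Prod.fst, measurable_snd,
      measurable_fst, hπ2, fun t => ?_, _, measurable_fst.comap_le, le_rfl, hπ⟩
    rw [hπ1]
    exact ⟨cdf_map_anti hf hψUm (fun ω => (hfmem ω).2) t,
      cdf_map_anti hψLm hf (fun ω => (hfmem ω).1) t⟩
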